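/- Let (Ω, F, P) be a probability space and Y = (Y_t)_{t≥0} a jointly measurable real-valued stochastic process such that there is an even function r : ℝ → ℝ with r(0) = 1 and, for every finite collection t₁, …, t_k ≥ 0 and reals c₁, …, c_k, the random variable Σᵢ cᵢ·Y_{tᵢ} is centered Gaussian with variance Σᵢ Σⱼ cᵢ·cⱼ·r(tᵢ − tⱼ). Assume there exist H ∈ (1/2, 1) and a finite constant C such that lim_{t→∞} r(t)/t^{2H−2} = C. Let α₊, α₋ > 0 with α₊ ≠ α₋, let X_t = α₊·Y_t·1_{Y_t>0} + α₋·Y_t·1_{Y_t<0}, let μ̂_i(T) = (1/T)·∫₀^T X_u^i du, and let μ₁ = (α₊ − α₋)/√(2π), μ₂ = (α₊² + α₋²)/2. Then there exists a symmetric positive semidefinite 2×2 real matrix Σ such that the ℝ²-valued random vectors T^{1−H}·(μ̂₁(T) − μ₁, μ̂₂(T) − μ₂) converge in distribution, as T → ∞, to a centered bivariate Gaussian vector with covariance matrix Σ. -/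

import Mathlib

open MeasureTheory ProbabilityTheory Real Filter Set

theorem integral_abs_gaussianReal_zero_one :
    ∫ x, |x| ∂(gaussianReal 0 1) = √(2 / π) := by
  rw [integral_gaussianReal_eq_integral_smul one_ne_zero]
  have h1 : ∀ x : ℝ, gaussianPDFReal 0 1 x • |x|
      = (fun y : ℝ => (√(2 * π))⁻¹ * (y ^ (1 : ℝ) * rexp (-(1 / 2) * y ^ 2))) |x| := by
    intro x
    simp only [gaussianPDFReal, NNReal.coe_one, mul_one, sub_zero, smul_eq_mul, rpow_one, sq_abs]
    rw [show -x ^ 2 / 2 = -(1 / 2) * x ^ 2 by ring]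
    ring
  simp_rw [h1]
  rw [integral_comp_abs (f := fun y : ℝ => (√(2 * π))⁻¹ * (y ^ (1 : ℝ) * rexp (-(1 / 2) * y ^ 2))),
    integral_const_mul]
  have h2 := integral_rpow_mul_exp_neg_mul_rpow (p := 2) (q := 1) (b := 1 / 2) (by norm_num)
    (by norm_num) (by norm_num)
  simp only [Real.rpow_two] at h2
  rw [h2]
  norm_num [Real.Gamma_one, Real.rpow_neg]
  have : 0 < √π := by positivity
  have h3 : √2 * √2 = 2 := by norm_num
  field_simp
  nlinarith

theorem integrable_pow_gaussianReal (v : NNReal) (n : ℕ) :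
    Integrable (fun x : ℝ => x ^ n) (gaussianReal 0 v) := by
  have h := (memLp_id_gaussianReal (μ := 0) (v := v) n)
  rcases Nat.eq_zero_or_pos n with rfl | hn
  · simp
  have := h.integrable_norm_pow hn.ne'
  rw [← integrable_norm_iff (by fun_prop)]
  simpa [norm_pow] using this

theorem integral_sq_gaussianReal (v : NNReal) :
    ∫ x, x ^ 2 ∂(gaussianReal 0 v) = v := by
  have h := variance_fun_id_gaussianReal (μ := 0) (v := v)
  rw [variance_eq_integral (by fun_prop)] at h
  simpa [integral_id_gaussianReal] using h

theorem gaussianReal_zero_one_le_volume : gaussianReal 0 1 ≤ (volume : Measure ℝ) := by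
  rw [gaussianReal_of_var_ne_zero _ one_ne_zero]
  calc _ ≤ volume.withDensity (1 : ℝ → ENNReal) := by
        refine withDensity_mono (ae_of_all _ fun x => ?_)
        rw [gaussianPDF, Pi.one_apply, ENNReal.ofReal_le_one, gaussianPDFReal]
        have h1 : 1 ≤ √(2 * π * (1 : NNReal)) := by
          rw [Real.one_le_sqrt]
          simp
          nlinarith [Real.pi_gt_three]
        have h2 : rexp (-(x - 0) ^ 2 / (2 * (1 : NNReal))) ≤ 1 := by
          rw [Real.exp_le_one_iff]
          simp
          nlinarith [sq_nonneg x]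
        exact mul_le_one₀ (inv_le_one_of_one_le₀ h1) (Real.exp_pos _).le h2
    _ = volume := by simp

theorem integral_comp_neg_gaussianReal (v : NNReal) (f : ℝ → ℝ) :
    ∫ x, f (-x) ∂(gaussianReal 0 v) = ∫ x, f x ∂(gaussianReal 0 v) := by
  have h : (gaussianReal 0 v).map (fun x => -x) = gaussianReal 0 v := by
    simpa using gaussianReal_map_neg (μ := 0) (v := v)
  conv_rhs => rw [← h]
  exact ((MeasurableEquiv.neg ℝ).measurableEmbedding.integral_map f).symm

theorem gaussianReal_zero_one_map_const_mul (c : ℝ) :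
    (gaussianReal 0 1).map (fun x => c * x) = gaussianReal 0 (Real.toNNReal (c ^ 2)) := by
  rw [gaussianReal_map_const_mul, mul_zero, mul_one]
  congr 1
  rw [← NNReal.coe_inj, Real.coe_toNNReal _ (sq_nonneg c)]
  rfl

theorem map_prodMk_eq_of_gaussian_combinations {Ω : Type*} [MeasurableSpace Ω] {P : Measure Ω}
    [IsProbabilityMeasure P] {U V : Ω → ℝ} (hU : Measurable U) (hV : Measurable V) {ρ : ℝ}
    (hρ : |ρ| ≤ 1)
    (h : ∀ a b : ℝ, P.map (fun ω => a * U ω + b * V ω)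
      = gaussianReal 0 (Real.toNNReal (a ^ 2 + 2 * a * b * ρ + b ^ 2))) :
    P.map (fun ω => (U ω, V ω)) = ((gaussianReal 0 1).prod (gaussianReal 0 1)).map
      (fun p => (p.1, ρ * p.1 + √(1 - ρ ^ 2) * p.2)) := by
  have hm : Measurable (fun p : ℝ × ℝ => (p.1, ρ * p.1 + √(1 - ρ ^ 2) * p.2)) := by fun_prop
  have := Measure.isProbabilityMeasure_map (μ := P) (hU.prodMk hV).aemeasurable
  have := Measure.isProbabilityMeasure_map
    (μ := (gaussianReal 0 1).prod (gaussianReal 0 1)) hm.aemeasurable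
  have hσ : √(1 - ρ ^ 2) ^ 2 = 1 - ρ ^ 2 := Real.sq_sqrt (by nlinarith [abs_le.1 hρ])
  refine Measure.ext_of_charFunDual (funext fun L => ?_)
  rw [charFunDual_eq_charFun_map_one, charFunDual_eq_charFun_map_one]
  congr 1
  rw [Measure.map_map (by fun_prop) (by fun_prop), Measure.map_map (by fun_prop) (by fun_prop)]
  have hL : ∀ x y : ℝ, L (x, y) = L (1, 0) * x + L (0, 1) * y := by
    intro x y
    have : ((x, y) : ℝ × ℝ) = x • (1, 0) + y • (0, 1) := by simp
    rw [this, map_add, map_smul, map_smul]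
    simp [mul_comm]
  have e1 : (L ∘ fun ω => (U ω, V ω)) = fun ω => L (1, 0) * U ω + L (0, 1) * V ω :=
    funext fun ω => hL _ _
  set a := L (1, 0)
  set b := L (0, 1)
  have e2 : (L ∘ fun p : ℝ × ℝ => (p.1, ρ * p.1 + √(1 - ρ ^ 2) * p.2))
      = (fun p : ℝ × ℝ => (a + b * ρ) * p.1) + (fun p => (b * √(1 - ρ ^ 2)) * p.2) := by
    funext p
    simp only [Function.comp_apply, hL, Pi.add_apply]
    ring
  rw [e1, h, e2]
  have hi : IndepFun (fun p : ℝ × ℝ => (a + b * ρ) * p.1) (fun p => (b * √(1 - ρ ^ 2)) * p.2)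
      ((gaussianReal 0 1).prod (gaussianReal 0 1)) :=
    indepFun_prod (X := fun x => (a + b * ρ) * x) (Y := fun x => (b * √(1 - ρ ^ 2)) * x)
      (by fun_prop) (by fun_prop)
  have m1 : ((gaussianReal 0 1).prod (gaussianReal 0 1)).map (fun p : ℝ × ℝ => (a + b * ρ) * p.1)
      = gaussianReal 0 (Real.toNNReal ((a + b * ρ) ^ 2)) := by
    rw [← gaussianReal_zero_one_map_const_mul, ← Measure.fst_prod (μ := gaussianReal 0 1)
      (ν := gaussianReal 0 1), Measure.fst, Measure.map_map (by fun_prop) (by fun_prop)]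
    simp [Function.comp_def]
  have m2 : ((gaussianReal 0 1).prod (gaussianReal 0 1)).map
        (fun p : ℝ × ℝ => (b * √(1 - ρ ^ 2)) * p.2)
      = gaussianReal 0 (Real.toNNReal ((b * √(1 - ρ ^ 2)) ^ 2)) := by
    rw [← gaussianReal_zero_one_map_const_mul, ← Measure.snd_prod (μ := gaussianReal 0 1)
      (ν := gaussianReal 0 1), Measure.snd, Measure.map_map (by fun_prop) (by fun_prop)]
    simp [Function.comp_def]
  rw [gaussianReal_add_gaussianReal_of_indepFun hi m1 m2]
  congr 1
  · simp
  · rw [← Real.toNNReal_add (sq_nonneg _) (sq_nonneg _), mul_pow, hσ]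
    congr 1
    ring

theorem integrable_gaussianReal_of_abs_le {f : ℝ → ℝ} (hf : Measurable f) {K : ℝ}
    (hK : ∀ x, |f x| ≤ K * (1 + x ^ 2)) : Integrable f (gaussianReal 0 1) := by
  refine Integrable.mono' (g := fun x => K * (1 + x ^ 2)) ?_ hf.aestronglyMeasurable
    (ae_of_all _ hK)
  exact ((integrable_const 1).add (integrable_pow_gaussianReal 1 2)).const_mul K

theorem integral_eq_integral_symmetrization {f : ℝ → ℝ} (hf : Integrable f (gaussianReal 0 1)) :
    ∫ x, f x ∂(gaussianReal 0 1) = ∫ x, (f x + f (-x)) / 2 ∂(gaussianReal 0 1) := by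
  have hn : Integrable (fun x => f (-x)) (gaussianReal 0 1) := by
    have h : (gaussianReal 0 1).map (fun x => -x) = gaussianReal 0 1 := by
      simpa using gaussianReal_map_neg (μ := 0) (v := 1)
    rw [← h] at hf
    exact hf.comp_measurable measurable_neg
  rw [integral_div, integral_add hf hn, integral_comp_neg_gaussianReal]
  ring

theorem sqrt_two_div_pi_le_one : √(2 / π) ≤ 1 := by
  rw [Real.sqrt_le_iff, one_pow, div_le_one Real.pi_pos]
  refine ⟨zero_le_one, ?_⟩
  linarith [Real.pi_gt_three]

theorem one_sub_sq_le_sqrt {ρ : ℝ} (hρ : |ρ| ≤ 1) : 1 - ρ ^ 2 ≤ √(1 - ρ ^ 2) := by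
  have h : 0 ≤ 1 - ρ ^ 2 := by nlinarith [abs_le.1 hρ]
  exact Real.le_sqrt_of_sq_le (by nlinarith [sq_nonneg ρ])

theorem sqrt_one_sub_sq_le_one (ρ : ℝ) : √(1 - ρ ^ 2) ≤ 1 := by
  rw [Real.sqrt_le_iff]
  refine ⟨zero_le_one, ?_⟩
  nlinarith [sq_nonneg ρ]

/-- Functions of at most quadratic growth on which the Ornstein–Uhlenbeck (Mehler) operator with
correlation `ρ` contracts at rate `ρ ^ 2`; this forces Hermite rank at least two. -/
def HasHermiteRankTwo (g : ℝ → ℝ) : Prop :=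
  Measurable g ∧ ∃ K, 0 ≤ K ∧ (∀ x, |g x| ≤ K * (1 + x ^ 2)) ∧
    ∀ ρ, |ρ| ≤ 1 → ∀ x,
      |∫ a, g (ρ * x + √(1 - ρ ^ 2) * a) ∂(gaussianReal 0 1)| ≤ K * ρ ^ 2 * (1 + x ^ 2)

theorem integrable_comp_affine {g : ℝ → ℝ} (hg : Measurable g) {K : ℝ} (hK0 : 0 ≤ K)
    (hK : ∀ x, |g x| ≤ K * (1 + x ^ 2)) (m s : ℝ) :
    Integrable (fun a => g (m + s * a)) (gaussianReal 0 1) := by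
  refine integrable_gaussianReal_of_abs_le (hg.comp (by fun_prop))
    (K := K * (1 + 2 * m ^ 2 + 2 * s ^ 2)) fun a => (hK _).trans ?_
  rw [mul_assoc]
  refine mul_le_mul_of_nonneg_left ?_ hK0
  nlinarith [sq_nonneg (m - s * a), sq_nonneg (m * a), sq_nonneg s, sq_nonneg a, sq_nonneg m]

theorem HasHermiteRankTwo.of_small {g : ℝ → ℝ} (hg : Measurable g) {K : ℝ} (hK0 : 0 ≤ K)
    (hK : ∀ x, |g x| ≤ K * (1 + x ^ 2))
    (h : ∀ ρ, |ρ| ≤ 1 / 2 → ∀ x,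
      |∫ a, g (ρ * x + √(1 - ρ ^ 2) * a) ∂(gaussianReal 0 1)| ≤ K * ρ ^ 2 * (1 + x ^ 2)) :
    HasHermiteRankTwo g := by
  refine ⟨hg, 12 * K, by positivity, fun x => (hK x).trans ?_, fun ρ hρ x => ?_⟩
  · nlinarith [mul_nonneg hK0 (sq_nonneg x)]
  rcases le_or_gt |ρ| (1 / 2) with h1 | h1
  · refine (h ρ h1 x).trans ?_
    have : 0 ≤ K * ρ ^ 2 * (1 + x ^ 2) := by positivity
    linarith
  · have hρ2 : 1 / 4 ≤ ρ ^ 2 := by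
      rw [← sq_abs]; nlinarith
    have hs : √(1 - ρ ^ 2) ^ 2 ≤ 1 := by
      nlinarith [sqrt_one_sub_sq_le_one ρ, Real.sqrt_nonneg (1 - ρ ^ 2)]
    have hρ1 : ρ ^ 2 ≤ 1 := by nlinarith [abs_le.1 hρ]
    set s := √(1 - ρ ^ 2)
    have hi2 := integrable_pow_gaussianReal 1 2
    calc |∫ a, g (ρ * x + s * a) ∂(gaussianReal 0 1)|
        ≤ ∫ a, |g (ρ * x + s * a)| ∂(gaussianReal 0 1) := abs_integral_le_integral_abs
      _ ≤ ∫ a, (K * (1 + 2 * x ^ 2) + (2 * K) * a ^ 2) ∂(gaussianReal 0 1) := by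
        refine integral_mono (integrable_comp_affine hg hK0 hK _ _).abs
          ((integrable_const _).add (hi2.const_mul _)) fun a => (hK _).trans ?_
        have : 1 + (ρ * x + s * a) ^ 2 ≤ 1 + 2 * x ^ 2 + 2 * a ^ 2 := by
          nlinarith [sq_nonneg (ρ * x - s * a), mul_nonneg (sub_nonneg.2 hρ1) (sq_nonneg x),
            mul_nonneg (sub_nonneg.2 hs) (sq_nonneg a)]
        exact (mul_le_mul_of_nonneg_left this hK0).trans (le_of_eq (by ring))
      _ = K * (1 + 2 * x ^ 2) + 2 * K := by
        rw [integral_add (integrable_const _) (hi2.const_mul _), integral_const_mul (2 * K),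
          integral_sq_gaussianReal]
        simp
      _ ≤ 12 * K * ρ ^ 2 * (1 + x ^ 2) := by
        nlinarith [mul_nonneg (mul_nonneg hK0 (sub_nonneg.2 hρ2))
          (by positivity : 0 ≤ 1 + x ^ 2), mul_nonneg hK0 (sq_nonneg x)]

theorem HasHermiteRankTwo.const_mul {g : ℝ → ℝ} (hg : HasHermiteRankTwo g) (c : ℝ) :
    HasHermiteRankTwo (fun x => c * g x) := by
  obtain ⟨hm, K, hK0, hK, h⟩ := hg
  refine ⟨hm.const_mul c, |c| * K, by positivity, fun x => ?_, fun ρ hρ x => ?_⟩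
  · rw [abs_mul, mul_assoc]
    exact mul_le_mul_of_nonneg_left (hK x) (abs_nonneg c)
  · rw [integral_const_mul, abs_mul, mul_assoc, mul_assoc, ← mul_assoc K]
    exact mul_le_mul_of_nonneg_left (h ρ hρ x) (abs_nonneg c)

theorem HasHermiteRankTwo.add {g h : ℝ → ℝ} (hg : HasHermiteRankTwo g)
    (hh : HasHermiteRankTwo h) : HasHermiteRankTwo (fun x => g x + h x) := by
  obtain ⟨hm, K, hK0, hK, hr⟩ := hg
  obtain ⟨hm', K', hK0', hK', hr'⟩ := hh
  refine ⟨hm.add hm', K + K', by positivity, fun x => ?_, fun ρ hρ x => ?_⟩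
  · rw [add_mul]
    exact (abs_add_le _ _).trans (add_le_add (hK x) (hK' x))
  · rw [integral_add (integrable_comp_affine hm hK0 hK _ _)
      (integrable_comp_affine hm' hK0' hK' _ _), add_mul, add_mul]
    exact (abs_add_le _ _).trans (add_le_add (hr ρ hρ x) (hr' ρ hρ x))

theorem hasHermiteRankTwo_sq_sub_one : HasHermiteRankTwo (fun x => x ^ 2 - 1) := by
  refine ⟨by fun_prop, 1, zero_le_one, fun x => ?_, fun ρ hρ x => ?_⟩
  · rw [abs_le]; constructor <;> nlinarith [sq_nonneg x]
  · have h1 : ∀ a : ℝ, (ρ * x + √(1 - ρ ^ 2) * a) ^ 2 - 1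
        = ((ρ * x) ^ 2 - 1) + (2 * (ρ * x) * √(1 - ρ ^ 2) * a + (1 - ρ ^ 2) * a ^ 2) := by
      intro a
      have hσ : √(1 - ρ ^ 2) ^ 2 = 1 - ρ ^ 2 := Real.sq_sqrt (by nlinarith [abs_le.1 hρ])
      linear_combination a ^ 2 * hσ
    have hi1 : Integrable (fun a : ℝ => a) (gaussianReal 0 1) := by
      simpa using integrable_pow_gaussianReal 1 1
    have hi2 := integrable_pow_gaussianReal 1 2
    simp_rw [h1]
    have hi3 : Integrable (fun a => 2 * (ρ * x) * √(1 - ρ ^ 2) * a + (1 - ρ ^ 2) * a ^ 2)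
        (gaussianReal 0 1) := (hi1.const_mul _).add (hi2.const_mul _)
    rw [integral_add (integrable_const _) hi3,
      integral_add (hi1.const_mul _) (hi2.const_mul _), integral_const_mul, integral_const_mul,
      integral_sq_gaussianReal, integral_id_gaussianReal]
    simp only [integral_const, probReal_univ, smul_eq_mul, NNReal.coe_one]
    rw [abs_le]
    constructor <;> nlinarith [mul_nonneg (sq_nonneg ρ) (sq_nonneg x), sq_nonneg ρ]

theorem hasHermiteRankTwo_mul_abs_sub :
    HasHermiteRankTwo (fun x => x * |x| - 2 * √(2 / π) * x) := by
  have hκ := sqrt_two_div_pi_le_one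
  have hκ0 := Real.sqrt_nonneg (2 / π)
  have hκe := integral_abs_gaussianReal_zero_one
  set κ := √(2 / π)
  have hgr : ∀ x : ℝ, |x * |x| - 2 * κ * x| ≤ 3 * (1 + x ^ 2) := by
    intro x
    have h1 : |(x * |x|)| = x ^ 2 := by rw [abs_mul, abs_abs, ← sq, sq_abs]
    have h2 : |2 * κ * x| ≤ 2 * |x| := by
      rw [abs_mul, abs_mul, abs_of_nonneg hκ0, abs_two]
      nlinarith [abs_nonneg x]
    refine (abs_sub _ _).trans ?_
    nlinarith [sq_nonneg (|x| - 1), sq_abs x]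
  have hm : Measurable (fun x : ℝ => x * |x| - 2 * κ * x) := by fun_prop
  refine ⟨hm, 3, by norm_num, hgr, fun ρ hρ x => ?_⟩
  have hs1 := one_sub_sq_le_sqrt hρ
  have hs2 := sqrt_one_sub_sq_le_one ρ
  have hs0 := Real.sqrt_nonneg (1 - ρ ^ 2)
  rw [integral_eq_integral_symmetrization (integrable_comp_affine hm (by norm_num) hgr _ _)]
  set s := √(1 - ρ ^ 2)
  set m := ρ * x with hmdef
  have hiabs : Integrable (fun a : ℝ => |a|) (gaussianReal 0 1) := by
    simpa using (integrable_pow_gaussianReal 1 1).abs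
  have key : ∀ a : ℝ, |((m + s * a) * |m + s * a| - 2 * κ * (m + s * a)
      + ((m + s * -a) * |m + s * -a| - 2 * κ * (m + s * -a))) / 2
      - (2 * m * s * |a| - 2 * κ * m)| ≤ m ^ 2 := by
    intro a
    have hsa : |s * a| = s * |a| := by rw [abs_mul, abs_of_nonneg hs0]
    rw [show 2 * m * s * |a| = 2 * m * |s * a| by rw [hsa]; ring, mul_neg]
    generalize s * a = b
    rw [abs_le]
    rcases abs_cases b with ⟨h1, h1'⟩ | ⟨h1, h1'⟩ <;>
    rcases abs_cases (m + b) with ⟨h2, h2'⟩ | ⟨h2, h2'⟩ <;>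
    rcases abs_cases (m + -b) with ⟨h3, h3'⟩ | ⟨h3, h3'⟩ <;>
    rw [h1, h2, h3] <;> constructor <;> nlinarith
  have hF : Integrable (fun a : ℝ => 2 * m * s * |a| - 2 * κ * m) (gaussianReal 0 1) :=
    (hiabs.const_mul _).sub (integrable_const _)
  have hFi : ∫ a, (2 * m * s * |a| - 2 * κ * m) ∂(gaussianReal 0 1) = 2 * m * κ * (s - 1) := by
    rw [integral_sub (hiabs.const_mul _) (integrable_const _), integral_const_mul, hκe]
    simp
    ring
  have hG : Integrable (fun a : ℝ => ((m + s * a) * |m + s * a| - 2 * κ * (m + s * a)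
      + ((m + s * -a) * |m + s * -a| - 2 * κ * (m + s * -a))) / 2) (gaussianReal 0 1) := by
    have e := fun t => integrable_comp_affine hm (by norm_num) hgr m t
    refine ((e s).add (e (-s))).div_const 2 |>.congr (ae_of_all _ fun a => ?_)
    simp
  have h1 : |∫ a, (((m + s * a) * |m + s * a| - 2 * κ * (m + s * a)
      + ((m + s * -a) * |m + s * -a| - 2 * κ * (m + s * -a))) / 2
      - (2 * m * s * |a| - 2 * κ * m)) ∂(gaussianReal 0 1)| ≤ m ^ 2 := by
    refine abs_integral_le_integral_abs.trans ?_
    refine (integral_mono (hG.sub hF).abs (integrable_const (m ^ 2)) key).trans ?_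
    simp
  rw [integral_sub hG hF, hFi] at h1
  have h2 : |2 * m * κ * (s - 1)| ≤ 2 * |x| * ρ ^ 2 := by
    rw [abs_mul, abs_mul, abs_mul, abs_two, abs_of_nonneg hκ0, abs_of_nonpos (by linarith : s - 1 ≤ 0)]
    have hmx : |m| ≤ |x| := by
      rw [hmdef, abs_mul]; nlinarith [abs_nonneg x]
    calc 2 * |m| * κ * -(s - 1) ≤ 2 * |x| * 1 * ρ ^ 2 := by
          gcongr
          · linarith
          · linarith
      _ = _ := by ring
  have h3 := abs_add_le _ _ |>.trans (add_le_add h1 h2)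
  rw [sub_add_cancel] at h3
  refine h3.trans ?_
  have : 2 * |x| ≤ 1 + x ^ 2 := by nlinarith [sq_nonneg (|x| - 1), sq_abs x]
  rw [hmdef, mul_pow]
  nlinarith [mul_le_mul_of_nonneg_left this (sq_nonneg ρ), sq_nonneg ρ,
    mul_nonneg (sq_nonneg ρ) (sq_nonneg x)]

theorem hasHermiteRankTwo_abs_sub : HasHermiteRankTwo (fun x => |x| - √(2 / π)) := by
  have hκ := sqrt_two_div_pi_le_one
  have hκ0 := Real.sqrt_nonneg (2 / π)
  have hκe := integral_abs_gaussianReal_zero_one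
  set κ := √(2 / π)
  have hgr : ∀ x : ℝ, |(|x| - κ)| ≤ 5 * (1 + x ^ 2) := by
    intro x
    rw [abs_le]
    constructor <;> nlinarith [sq_nonneg (|x| - 1), sq_abs x, abs_nonneg x]
  have hm : Measurable (fun x : ℝ => |x| - κ) := by fun_prop
  refine .of_small hm (K := 5) (by norm_num) hgr fun ρ hρ x => ?_
  have hρ' : |ρ| ≤ 1 := by linarith
  have hs1 := one_sub_sq_le_sqrt hρ'
  have hs2 := sqrt_one_sub_sq_le_one ρ
  rw [integral_eq_integral_symmetrization (integrable_comp_affine hm (by norm_num) hgr _ _)]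
  set s := √(1 - ρ ^ 2)
  have hshalf : 1 / 2 ≤ s := by nlinarith [abs_le.1 hρ]
  have hs0 : 0 ≤ s := by linarith
  set m := ρ * x with hmdef
  have hiabs : Integrable (fun a : ℝ => |a|) (gaussianReal 0 1) := by
    simpa using (integrable_pow_gaussianReal 1 1).abs
  have hF : Integrable (fun a : ℝ => s * |a| - κ) (gaussianReal 0 1) :=
    (hiabs.const_mul _).sub (integrable_const _)
  have hFi : ∫ a, (s * |a| - κ) ∂(gaussianReal 0 1) = κ * (s - 1) := by
    rw [integral_sub (hiabs.const_mul _) (integrable_const _), integral_const_mul, hκe]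
    simp
    ring
  have hG : Integrable (fun a : ℝ => ((|m + s * a| - κ) + (|m + s * -a| - κ)) / 2)
      (gaussianReal 0 1) := by
    have e := fun t => integrable_comp_affine hm (by norm_num) hgr m t
    refine ((e s).add (e (-s))).div_const 2 |>.congr (ae_of_all _ fun a => ?_)
    simp
  have hI : MeasurableSet (Icc (-(2 * |m|)) (2 * |m|)) := measurableSet_Icc
  have key : ∀ a : ℝ, |((|m + s * a| - κ) + (|m + s * -a| - κ)) / 2 - (s * |a| - κ)|
      ≤ (Icc (-(2 * |m|)) (2 * |m|)).indicator (fun _ => |m|) a := by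
    intro a
    have hsa : |s * a| = s * |a| := by rw [abs_mul, abs_of_nonneg hs0]
    have hmax : (|m + s * a| + |m + s * -a|) / 2 = max |m| (s * |a|) := by
      rw [← hsa, mul_neg]
      generalize s * a = b
      rcases abs_cases b with ⟨h1, h1'⟩ | ⟨h1, h1'⟩ <;>
      rcases abs_cases m with ⟨h4, h4'⟩ | ⟨h4, h4'⟩ <;>
      rcases abs_cases (m + b) with ⟨h2, h2'⟩ | ⟨h2, h2'⟩ <;>
      rcases abs_cases (m + -b) with ⟨h3, h3'⟩ | ⟨h3, h3'⟩ <;>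
      rw [h1, h2, h3, h4, max_def] <;> split_ifs <;> linarith
    rw [show ((|m + s * a| - κ) + (|m + s * -a| - κ)) / 2 - (s * |a| - κ)
      = (|m + s * a| + |m + s * -a|) / 2 - s * |a| by ring, hmax]
    have ha := abs_nonneg a
    have hm0 := abs_nonneg m
    rcases le_total |m| (s * |a|) with h | h
    · rw [max_eq_right h, sub_self, abs_zero]
      exact indicator_nonneg (fun _ _ => hm0) _
    · have : a ∈ Icc (-(2 * |m|)) (2 * |m|) := by
        rw [mem_Icc, ← abs_le]; nlinarith
      rw [indicator_of_mem this, max_eq_left h, abs_of_nonneg (by linarith)]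
      nlinarith
  have h1 : |∫ a, (((|m + s * a| - κ) + (|m + s * -a| - κ)) / 2 - (s * |a| - κ))
      ∂(gaussianReal 0 1)| ≤ 4 * m ^ 2 := by
    refine abs_integral_le_integral_abs.trans ?_
    refine (integral_mono (hG.sub hF).abs ((integrable_const |m|).indicator hI) key).trans ?_
    rw [integral_indicator_const _ hI, smul_eq_mul]
    have : (gaussianReal 0 1).real (Icc (-(2 * |m|)) (2 * |m|)) ≤ 4 * |m| := by
      refine (ENNReal.toReal_mono (by simp) (gaussianReal_zero_one_le_volume _)).trans ?_
      rw [Real.volume_Icc, ENNReal.toReal_ofReal (by linarith [abs_nonneg m])]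
      linarith
    rw [← sq_abs m]
    nlinarith [abs_nonneg m]
  rw [integral_sub hG hF, hFi] at h1
  have h2 : |κ * (s - 1)| ≤ ρ ^ 2 := by
    rw [abs_mul, abs_of_nonneg hκ0, abs_of_nonpos (by linarith : s - 1 ≤ 0)]
    nlinarith
  have h3 := abs_add_le _ _ |>.trans (add_le_add h1 h2)
  rw [sub_add_cancel] at h3
  refine h3.trans ?_
  rw [hmdef, mul_pow]
  nlinarith [mul_nonneg (sq_nonneg ρ) (sq_nonneg x), sq_nonneg ρ]

theorem integrable_mul_comp_correlated {g h : ℝ → ℝ} (hg : Measurable g) (hh : Measurable h)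
    {K L : ℝ} (hK0 : 0 ≤ K) (hL0 : 0 ≤ L) (hK : ∀ x, |g x| ≤ K * (1 + x ^ 2))
    (hL : ∀ x, |h x| ≤ L * (1 + x ^ 2)) (ρ s : ℝ) :
    Integrable (fun p : ℝ × ℝ => g p.1 * h (ρ * p.1 + s * p.2))
      ((gaussianReal 0 1).prod (gaussianReal 0 1)) := by
  have hb : Integrable (fun p : ℝ × ℝ => K * L * (1 + 2 * ρ ^ 2 + 2 * s ^ 2) *
      ((1 + p.1 ^ 2) ^ 2 * (1 + p.2 ^ 2))) ((gaussianReal 0 1).prod (gaussianReal 0 1)) := by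
    refine Integrable.const_mul (Integrable.mul_prod (f := fun x : ℝ => (1 + x ^ 2) ^ 2)
      (g := fun x : ℝ => 1 + x ^ 2) ?_ ?_) _
    · have h2 := integrable_pow_gaussianReal 1 2
      have h4 := integrable_pow_gaussianReal 1 4
      refine (((integrable_const (1 : ℝ)).add (h2.const_mul 2)).add h4).congr
        (ae_of_all _ fun x => ?_)
      simp only [Pi.add_apply]
      ring
    · exact (integrable_const (1 : ℝ)).add (integrable_pow_gaussianReal 1 2)
  refine hb.mono' (by fun_prop) (ae_of_all _ fun p => ?_)
  rw [Real.norm_eq_abs, abs_mul]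
  have h1 : |h (ρ * p.1 + s * p.2)| ≤
      L * ((1 + 2 * ρ ^ 2 + 2 * s ^ 2) * ((1 + p.1 ^ 2) * (1 + p.2 ^ 2))) := by
    refine (hL _).trans (mul_le_mul_of_nonneg_left ?_ hL0)
    have : 0 ≤ p.1 ^ 2 := sq_nonneg _
    have : 0 ≤ p.2 ^ 2 := sq_nonneg _
    have : 0 ≤ ρ ^ 2 := sq_nonneg _
    have : 0 ≤ s ^ 2 := sq_nonneg _
    have : (ρ * p.1 + s * p.2) ^ 2 ≤ 2 * (ρ ^ 2 * p.1 ^ 2) + 2 * (s ^ 2 * p.2 ^ 2) := by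
      nlinarith [sq_nonneg (ρ * p.1 - s * p.2)]
    have e : (1 + 2 * ρ ^ 2 + 2 * s ^ 2) * ((1 + p.1 ^ 2) * (1 + p.2 ^ 2))
        = 1 + 2 * (ρ ^ 2 * p.1 ^ 2) + 2 * (s ^ 2 * p.2 ^ 2) + (p.1 ^ 2 + p.2 ^ 2
          + p.1 ^ 2 * p.2 ^ 2 + 2 * ρ ^ 2 + 2 * s ^ 2 + 2 * (ρ ^ 2 * p.2 ^ 2)
          + 2 * (s ^ 2 * p.1 ^ 2) + 2 * ρ ^ 2 * p.1 ^ 2 * p.2 ^ 2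
          + 2 * s ^ 2 * p.1 ^ 2 * p.2 ^ 2) := by ring
    rw [e]
    have : 0 ≤ p.1 ^ 2 + p.2 ^ 2
          + p.1 ^ 2 * p.2 ^ 2 + 2 * ρ ^ 2 + 2 * s ^ 2 + 2 * (ρ ^ 2 * p.2 ^ 2)
          + 2 * (s ^ 2 * p.1 ^ 2) + 2 * ρ ^ 2 * p.1 ^ 2 * p.2 ^ 2
          + 2 * s ^ 2 * p.1 ^ 2 * p.2 ^ 2 := by positivity
    linarith
  calc |g p.1| * |h (ρ * p.1 + s * p.2)| ≤ (K * (1 + p.1 ^ 2)) *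
        (L * ((1 + 2 * ρ ^ 2 + 2 * s ^ 2) * ((1 + p.1 ^ 2) * (1 + p.2 ^ 2)))) :=
        mul_le_mul (hK _) h1 (abs_nonneg _) (by positivity)
    _ = _ := by ring

theorem HasHermiteRankTwo.exists_abs_integral_le {g : ℝ → ℝ} (hg : HasHermiteRankTwo g) :
    ∃ K, 0 ≤ K ∧ ∀ ρ, |ρ| ≤ 1 →
      |∫ p : ℝ × ℝ, g p.1 * g (ρ * p.1 + √(1 - ρ ^ 2) * p.2)
        ∂((gaussianReal 0 1).prod (gaussianReal 0 1))| ≤ K * ρ ^ 2 := by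
  obtain ⟨hm, K, hK0, hK, hr⟩ := hg
  have h2 := integrable_pow_gaussianReal 1 2
  have h4 := integrable_pow_gaussianReal 1 4
  have hq : Integrable (fun x : ℝ => (1 + x ^ 2) ^ 2) (gaussianReal 0 1) := by
    refine (((integrable_const (1 : ℝ)).add (h2.const_mul 2)).add h4).congr
      (ae_of_all _ fun x => ?_)
    simp only [Pi.add_apply]
    ring
  refine ⟨K ^ 2 * ∫ x, (1 + x ^ 2) ^ 2 ∂(gaussianReal 0 1),
    mul_nonneg (sq_nonneg _) (integral_nonneg fun x => by positivity), fun ρ hρ => ?_⟩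
  have hi := integrable_mul_comp_correlated hm hm hK0 hK0 hK hK ρ √(1 - ρ ^ 2)
  rw [integral_prod _ hi]
  refine abs_integral_le_integral_abs.trans ?_
  rw [mul_right_comm, ← integral_const_mul]
  refine integral_mono hi.integral_prod_left.abs (hq.const_mul _) fun x => ?_
  simp only [integral_const_mul, abs_mul]
  calc |g x| * |∫ y, g (ρ * x + √(1 - ρ ^ 2) * y) ∂(gaussianReal 0 1)|
      ≤ (K * (1 + x ^ 2)) * (K * ρ ^ 2 * (1 + x ^ 2)) :=
        mul_le_mul (hK _) (hr ρ hρ x) (abs_nonneg _) (by positivity)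
    _ = _ := by ring

theorem integral_mul_correlated (ρ s : ℝ) :
    ∫ p : ℝ × ℝ, p.1 * (ρ * p.1 + s * p.2) ∂((gaussianReal 0 1).prod (gaussianReal 0 1)) = ρ := by
  have hgr : ∀ x : ℝ, |x| ≤ 1 * (1 + x ^ 2) := fun x => by
    nlinarith [sq_nonneg (|x| - 1), sq_abs x, abs_nonneg x]
  rw [integral_prod _ (integrable_mul_comp_correlated (g := fun x => x) (h := fun x => x) measurable_id
    measurable_id zero_le_one zero_le_one hgr hgr ρ s)]
  have h1 : ∀ x : ℝ, ∫ y, x * (ρ * x + s * y) ∂(gaussianReal 0 1) = ρ * x ^ 2 := by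
    intro x
    have hi1 : Integrable (fun a : ℝ => a) (gaussianReal 0 1) := by
      simpa using integrable_pow_gaussianReal 1 1
    rw [integral_const_mul, integral_add (integrable_const _) (hi1.const_mul _),
      integral_const_mul s, integral_id_gaussianReal]
    simp
    ring
  simp_rw [h1]
  rw [integral_const_mul, integral_sq_gaussianReal]
  simp

section SecondMoment

variable {V Ω : Type*} [MeasurableSpace V] [MeasurableSpace Ω] {ν : Measure V} {P : Measure Ω}
  [IsProbabilityMeasure ν] [IsProbabilityMeasure P] {F : V → Ω → ℝ}

theorem integrable_sq_uncurry (hF : Measurable (Function.uncurry F)) {M : ℝ}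
    (h2 : ∀ᵐ v ∂ν, Integrable (fun ω => F v ω ^ 2) P)
    (hM : ∀ᵐ v ∂ν, ∫ ω, F v ω ^ 2 ∂P ≤ M) :
    Integrable (fun p : V × Ω => F p.1 p.2 ^ 2) (ν.prod P) := by
  have hm : Measurable (fun p : V × Ω => F p.1 p.2 ^ 2) := hF.pow_const 2
  rw [integrable_prod_iff hm.aestronglyMeasurable]
  refine ⟨h2, Integrable.mono' (integrable_const M) ?_ ?_⟩
  · exact (hm.norm.stronglyMeasurable.integral_prod_right).aestronglyMeasurable
  · filter_upwards [hM] with v hv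
    rw [Real.norm_of_nonneg (integral_nonneg fun ω => norm_nonneg _)]
    simpa using hv

theorem integrable_mul_prod_prod (hF : Measurable (Function.uncurry F))
    (hi : Integrable (fun p : V × Ω => F p.1 p.2 ^ 2) (ν.prod P)) :
    Integrable (fun p : (V × V) × Ω => F p.1.1 p.2 * F p.1.2 p.2) ((ν.prod ν).prod P) := by
  have m1 : MeasurePreserving (fun p : (V × V) × Ω => (p.1.1, p.2)) ((ν.prod ν).prod P)
      (ν.prod P) := measurePreserving_fst.prod (MeasurePreserving.id P)
  have m2 : MeasurePreserving (fun p : (V × V) × Ω => (p.1.2, p.2)) ((ν.prod ν).prod P)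
      (ν.prod P) := measurePreserving_snd.prod (MeasurePreserving.id P)
  have i1 := m1.integrable_comp_of_integrable hi
  have i2 := m2.integrable_comp_of_integrable hi
  refine ((i1.add i2).div_const 2).mono' ?_ (ae_of_all _ fun p => ?_)
  · exact ((hF.comp m1.measurable).mul (hF.comp m2.measurable)).aestronglyMeasurable
  · simp only [Function.comp_apply, Pi.add_apply, Real.norm_eq_abs]
    rw [abs_le]
    constructor <;> nlinarith [sq_nonneg (F p.1.1 p.2 + F p.1.2 p.2),
      sq_nonneg (F p.1.1 p.2 - F p.1.2 p.2)]

theorem memLp_two_integral (hF : Measurable (Function.uncurry F))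
    (hi : Integrable (fun p : V × Ω => F p.1 p.2 ^ 2) (ν.prod P)) :
    MemLp (fun ω => ∫ v, F v ω ∂ν) 2 P := by
  have hm : Measurable (fun ω => ∫ v, F v ω ∂ν) :=
    (hF.stronglyMeasurable.integral_prod_left').measurable
  rw [memLp_two_iff_integrable_sq hm.aestronglyMeasurable]
  refine (integrable_mul_prod_prod hF hi).integral_prod_right.congr (ae_of_all _ fun ω => ?_)
  simp only
  rw [integral_prod_mul (fun v => F v ω) (fun v => F v ω), sq]

theorem integral_sq_integral (hF : Measurable (Function.uncurry F))
    (hi : Integrable (fun p : V × Ω => F p.1 p.2 ^ 2) (ν.prod P)) :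
    ∫ ω, (∫ v, F v ω ∂ν) ^ 2 ∂P
      = ∫ p : V × V, (∫ ω, F p.1 ω * F p.2 ω ∂P) ∂(ν.prod ν) := by
  rw [integral_integral_swap (integrable_mul_prod_prod hF hi)]
  refine integral_congr_ae (ae_of_all _ fun ω => ?_)
  simp only
  rw [integral_prod_mul (fun v => F v ω) (fun v => F v ω), sq]

end SecondMoment

/-- The uniform distribution on `(0, 1]`. -/
noncomputable def unitUniform : Measure ℝ := volume.restrict (Ioc 0 1)

instance : IsProbabilityMeasure unitUniform := ⟨by simp [unitUniform]⟩

theorem ae_pos_unitUniform : ∀ᵐ v ∂unitUniform, 0 < v := by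
  filter_upwards [ae_restrict_mem measurableSet_Ioc] with v hv using hv.1

theorem ae_pos_unitUniform_prod :
    ∀ᵐ p ∂(unitUniform.prod unitUniform), 0 < p.1 ∧ 0 < p.2 :=
  (Measure.quasiMeasurePreserving_fst.ae ae_pos_unitUniform).and
    (Measure.quasiMeasurePreserving_snd.ae ae_pos_unitUniform)

theorem ae_ne_unitUniform_prod : ∀ᵐ p ∂(unitUniform.prod unitUniform), p.1 - p.2 ≠ 0 := by
  have hs : MeasurableSet {p : ℝ × ℝ | p.1 - p.2 = 0} :=
    measurableSet_eq_fun (by fun_prop) (by fun_prop)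
  rw [ae_iff]
  simp only [ne_eq, not_not]
  rw [Measure.measure_prod_null hs]
  refine ae_of_all _ fun x => ?_
  have : Prod.mk x ⁻¹' {p : ℝ × ℝ | p.1 - p.2 = 0} ⊆ {x} := by
    intro y hy
    simp only [mem_preimage, mem_ofPred_eq] at hy
    simp only [mem_singleton_iff]
    linarith
  refine measure_mono_null this ?_
  simp [unitUniform]

theorem integrable_abs_sub_rpow {p : ℝ} (hp : -1 < p) :
    Integrable (fun q : ℝ × ℝ => |q.1 - q.2| ^ p) (unitUniform.prod unitUniform) := by
  have h1 : Integrable ((Icc (-1 : ℝ) 1).indicator fun x : ℝ => |x| ^ p) := by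
    rw [integrable_indicator_iff measurableSet_Icc]
    have h := intervalIntegral.intervalIntegrable_rpow' (a := 0) (b := 1) hp
    have h' : IntervalIntegrable (fun x : ℝ => |x| ^ p) volume 0 1 := by
      refine h.congr fun x hx => ?_
      rw [uIoc_of_le zero_le_one] at hx
      simp [abs_of_pos hx.1]
    have h'' : IntervalIntegrable (fun x : ℝ => |x| ^ p) volume 0 (-1) := by
      rw [IntervalIntegrable.iff_comp_neg]
      simpa using h'
    rw [integrableOn_Icc_iff_integrableOn_Ioc,
      ← intervalIntegrable_iff_integrableOn_Ioc_of_le (by norm_num)]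
    exact h''.symm.trans h'
  have h2 : Integrable ((Icc (0 : ℝ) 1).indicator fun _ : ℝ => (1 : ℝ)) :=
    (integrable_indicator_iff measurableSet_Icc).2 (by simp)
  have h3 := (h2.convolution_integrand (ContinuousLinearMap.mul ℝ ℝ) h1)
  have h4 := h3.mono_measure (μ := (unitUniform.prod unitUniform)) (by
    unfold unitUniform
    rw [Measure.prod_restrict]
    exact Measure.restrict_le_self)
  refine h4.congr ?_
  have hmem : ∀ᵐ v ∂unitUniform, v ∈ Ioc (0 : ℝ) 1 := ae_restrict_mem measurableSet_Ioc
  filter_upwards [Measure.quasiMeasurePreserving_fst.ae hmem,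
    Measure.quasiMeasurePreserving_snd.ae hmem] with q hq1 hq2
  have a1 : q.2 ∈ Icc (0 : ℝ) 1 := ⟨hq2.1.le, hq2.2⟩
  have a2 : q.1 - q.2 ∈ Icc (-1 : ℝ) 1 := ⟨by linarith [hq1.1, hq2.2], by linarith [hq1.2, hq2.1]⟩
  simp [indicator_of_mem a1, indicator_of_mem a2]

theorem exists_abs_le_rpow {h : ℝ → ℝ} (heven : ∀ t, h (-t) = h t) (hb : ∀ t, |h t| ≤ 1)
    {p : ℝ} (hp0 : p < 0) {C : ℝ} (hlim : Tendsto (fun t => h t / t ^ p) atTop (nhds C)) :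
    ∃ K, ∀ t, t ≠ 0 → |h t| ≤ K * |t| ^ p := by
  have h1 : ∀ᶠ t in atTop, |h t / t ^ p| < |C| + 1 :=
    hlim.abs.eventually_lt_const (by linarith)
  obtain ⟨T, hT⟩ := eventually_atTop.1 (h1.and (eventually_gt_atTop 0))
  have hT0 : 0 < T := (hT T le_rfl).2
  have hpos : ∀ t, 0 < t → |h t| ≤ (|C| + 1 + (T ^ p)⁻¹) * t ^ p := by
    intro t ht
    have htp : 0 < t ^ p := rpow_pos_of_pos ht p
    have hTp : 0 < T ^ p := rpow_pos_of_pos hT0 p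
    rcases le_total T t with hTt | hTt
    · have := (hT t hTt).1
      rw [abs_div, abs_of_pos htp, div_lt_iff₀ htp] at this
      have h3 : 0 < (T ^ p)⁻¹ * t ^ p := by positivity
      nlinarith
    · have h3 : T ^ p ≤ t ^ p := rpow_le_rpow_of_nonpos ht hTt hp0.le
      have h4 : 1 ≤ (T ^ p)⁻¹ * t ^ p := by
        rw [inv_mul_eq_div, one_le_div hTp]
        exact h3
      nlinarith [hb t, abs_nonneg C]
  refine ⟨|C| + 1 + (T ^ p)⁻¹, fun t ht => ?_⟩
  rcases abs_cases t with ⟨e, h0⟩ | ⟨e, h0⟩ <;> rw [e]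
  · exact hpos t (lt_of_le_of_ne h0 ht.symm)
  · rw [← heven]
    exact hpos _ (by linarith)

theorem tendsto_scaled_double_integral {h : ℝ → ℝ} (hm : Measurable h)
    (heven : ∀ t, h (-t) = h t) (hb : ∀ t, |h t| ≤ 1)
    {p : ℝ} (hp : -1 < p) (hp0 : p < 0) {C : ℝ}
    (hlim : Tendsto (fun t => h t / t ^ p) atTop (nhds C)) :
    Tendsto (fun T : ℝ => T ^ (-p) * ∫ q, h (T * (q.1 - q.2)) ∂(unitUniform.prod unitUniform)) atTop
      (nhds (∫ q, C * |q.1 - q.2| ^ p ∂(unitUniform.prod unitUniform))) := by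
  obtain ⟨K, hK⟩ := exists_abs_le_rpow heven hb hp0 hlim
  simp_rw [← integral_const_mul]
  refine tendsto_integral_filter_of_dominated_convergence (fun q => K * |q.1 - q.2| ^ p)
    (Eventually.of_forall fun T => (Measurable.aestronglyMeasurable (by fun_prop))) ?_
    ((integrable_abs_sub_rpow hp).const_mul K) ?_
  · filter_upwards [eventually_gt_atTop 0] with T hT
    filter_upwards [ae_ne_unitUniform_prod] with q hq
    have := hK (T * (q.1 - q.2)) (mul_ne_zero hT.ne' hq)
    rw [abs_mul T, abs_of_pos hT, mul_rpow hT.le (abs_nonneg _)] at this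
    have hTp := rpow_pos_of_pos hT (-p)
    rw [Real.norm_eq_abs, abs_mul, abs_of_pos hTp]
    refine (mul_le_mul_of_nonneg_left this hTp.le).trans (le_of_eq ?_)
    rw [rpow_neg hT.le]
    have := (rpow_pos_of_pos hT p).ne'
    field_simp
  · filter_upwards [ae_ne_unitUniform_prod] with q hq
    have hx : 0 < |q.1 - q.2| := abs_pos.2 hq
    have h1 : Tendsto (fun T : ℝ => T * |q.1 - q.2|) atTop atTop :=
      tendsto_id.atTop_mul_const hx
    refine ((hlim.comp h1).mul_const (|q.1 - q.2| ^ p)).congr' ?_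
    filter_upwards [eventually_gt_atTop 0] with T hT
    have e : h (T * (q.1 - q.2)) = h (T * |q.1 - q.2|) := by
      rcases abs_choice (q.1 - q.2) with e | e <;> rw [e]
      rw [mul_neg, heven]
    simp only [Function.comp_apply]
    rw [e, mul_rpow hT.le hx.le, rpow_neg hT.le]
    have := (rpow_pos_of_pos hT p).ne'
    have := (rpow_pos_of_pos hx p).ne'
    field_simp

theorem tendsto_sq_div_rpow {r : ℝ → ℝ} {p C : ℝ} (hp0 : p < 0)
    (hlim : Tendsto (fun t => r t / t ^ p) atTop (nhds C)) :
    Tendsto (fun t => r t ^ 2 / t ^ p) atTop (nhds 0) := by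
  have h0 : Tendsto (fun t : ℝ => t ^ p) atTop (nhds 0) := by
    simpa using tendsto_rpow_neg_atTop (y := -p) (by linarith)
  have := (hlim.mul hlim).mul h0
  rw [mul_zero] at this
  refine this.congr' ?_
  filter_upwards [eventually_gt_atTop 0] with t ht
  have := (rpow_pos_of_pos ht p).ne'
  field_simp

theorem isClosed_setOf_map_eq_gaussianReal {Ω : Type*} [MeasurableSpace Ω] (P : Measure Ω)
    [IsProbabilityMeasure P] :
    IsClosed {f : Lp ℝ 2 P | P.map f = gaussianReal 0 (Real.toNNReal (‖f‖ ^ 2))} := by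
  refine IsSeqClosed.isClosed fun z f hz hf => ?_
  have hd : TendstoInDistribution (fun n => (z n : Ω → ℝ)) atTop f (fun _ => P) P :=
    (tendstoInMeasure_of_tendsto_Lp hf).tendstoInDistribution
      fun n => (Lp.stronglyMeasurable (z n)).measurable.aemeasurable
  have hc := ProbabilityMeasure.tendsto_iff_tendsto_charFun.1 hd.tendsto
  have hfm : AEMeasurable f P := (Lp.stronglyMeasurable f).measurable.aemeasurable
  have := Measure.isProbabilityMeasure_map hfm
  refine Measure.ext_of_charFun (funext fun t => ?_)
  refine tendsto_nhds_unique (hc t) ?_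
  have hz' : ∀ n, P.map (z n) = gaussianReal 0 (Real.toNNReal (‖z n‖ ^ 2)) := hz
  simp only [ProbabilityMeasure.coe_mk, hz', charFun_gaussianReal]
  have hn : Tendsto (fun n => ‖z n‖) atTop (nhds ‖f‖) := hf.norm
  simp only [Real.coe_toNNReal _ (sq_nonneg _)]
  have hn' : Tendsto (fun n => ((‖z n‖ : ℝ) : ℂ)) atTop (nhds (‖f‖ : ℂ)) :=
    (Complex.continuous_ofReal.tendsto _).comp hn
  push_cast
  refine (Complex.continuous_exp.tendsto _).comp ?_
  exact tendsto_const_nhds.sub (((hn'.pow 2).mul_const _).div_const _)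

/-- The law `gaussianReal 0 v` as an element of the space of probability measures. -/
noncomputable def centeredGaussian (v : NNReal) : ProbabilityMeasure ℝ :=
  ⟨gaussianReal 0 v, inferInstance⟩

theorem coe_centeredGaussian (v : NNReal) : (centeredGaussian v : Measure ℝ) = gaussianReal 0 v :=
  rfl

theorem continuous_centeredGaussian : Continuous centeredGaussian := by
  refine SeqContinuous.continuous fun v w hv => ?_
  refine ProbabilityMeasure.tendsto_iff_tendsto_charFun.2 fun t => ?_
  simp only [Function.comp_apply, coe_centeredGaussian, charFun_gaussianReal]
  have hc : Continuous fun u : NNReal =>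
      Complex.exp (t * ((0 : ℝ) : ℂ) * Complex.I - ((u : ℝ) : ℂ) * t ^ 2 / 2) := by
    fun_prop
  exact (hc.tendsto w).comp hv

theorem tendstoInMeasure_zero_of_tendsto_integral_sq {Ω : Type*} [MeasurableSpace Ω]
    {P : Measure Ω} {R : ℝ → Ω → ℝ} (hm : ∀ T, Measurable (R T))
    (hL : ∀ᶠ T in atTop, MemLp (R T) 2 P)
    (hR : Tendsto (fun T => ∫ ω, R T ω ^ 2 ∂P) atTop (nhds 0)) :
    TendstoInMeasure P R atTop (fun _ => 0) := by
  refine tendstoInMeasure_of_tendsto_eLpNorm (p := 2) two_ne_zero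
    (fun T => (hm T).aestronglyMeasurable) aestronglyMeasurable_const ?_
  have h0 : Tendsto (fun T => ENNReal.ofReal ((∫ ω, R T ω ^ 2 ∂P) ^ (2 : ℝ)⁻¹)) atTop
      (nhds 0) := by
    have := ENNReal.tendsto_ofReal (hR.rpow_const (p := (2 : ℝ)⁻¹) (Or.inr (by norm_num)))
    simpa using this
  refine h0.congr' ?_
  filter_upwards [hL] with T hT
  rw [show (R T - fun _ => (0 : ℝ)) = R T by ext; simp,
    hT.eLpNorm_eq_integral_rpow_norm two_ne_zero (by simp)]
  simp

theorem inv_mul_setIntegral_Ioc (φ : ℝ → ℝ) {T : ℝ} (hT : 0 < T) :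
    (1 / T) * ∫ u in Set.Ioc (0 : ℝ) T, φ u = ∫ v, φ (T * v) ∂unitUniform := by
  have := intervalIntegral.integral_comp_mul_left (a := 0) (b := 1) φ hT.ne'
  rw [mul_zero, mul_one, intervalIntegral.integral_of_le zero_le_one,
    intervalIntegral.integral_of_le hT.le, smul_eq_mul] at this
  rw [one_div, ← this, unitUniform]

theorem sqrt_two_div_pi_eq : √(2 / π) = 2 / √(2 * π) := by
  rw [Real.sqrt_div zero_le_two, Real.sqrt_mul zero_le_two,
    div_eq_div_iff (by positivity) (by positivity), ← mul_assoc,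
    Real.mul_self_sqrt zero_le_two]

theorem map_linear_gaussianReal_pair (v : NNReal) (c₁ c₂ c d : ℝ) :
    ((gaussianReal 0 v).map (fun x => (c₁ * x, c₂ * x))).map (fun x => c * x.1 + d * x.2)
      = gaussianReal 0 (Real.toNNReal ((c * c₁ + d * c₂) ^ 2 * v)) := by
  rw [Measure.map_map (by fun_prop) (by fun_prop)]
  have e : ((fun x : ℝ × ℝ => c * x.1 + d * x.2) ∘ fun x => (c₁ * x, c₂ * x))
      = fun x => (c * c₁ + d * c₂) * x := by
    funext x
    simp only [Function.comp_apply]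
    ring
  rw [e, gaussianReal_map_const_mul, mul_zero]
  congr 1
  rw [← NNReal.coe_inj, Real.coe_toNNReal _ (by positivity)]
  simp

theorem norm_toLp_sq {Ω : Type*} [MeasurableSpace Ω] {P : Measure Ω} {f : Ω → ℝ}
    (hf : MemLp f 2 P) : ‖hf.toLp f‖ ^ 2 = ∫ ω, f ω ^ 2 ∂P := by
  rw [← real_inner_self_eq_norm_sq, L2.inner_def]
  refine integral_congr_ae ?_
  filter_upwards [hf.coeFn_toLp] with ω hω
  rw [hω, real_inner_self_eq_norm_sq, Real.norm_eq_abs, sq_abs]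

theorem abs_le_one_mul_one_add_sq (x : ℝ) : |x| ≤ 1 * (1 + x ^ 2) := by
  nlinarith [sq_nonneg (|x| - 1), sq_abs x, abs_nonneg x]

/-- A jointly measurable process whose restriction to nonnegative times is centered stationary
Gaussian with unit variance and covariance function `r`. -/
structure IsStationaryGaussian {Ω : Type*} [MeasurableSpace Ω] (P : Measure Ω)
    (Y : ℝ → Ω → ℝ) (r : ℝ → ℝ) : Prop where
  measurable : Measurable (Function.uncurry Y)
  even : ∀ t, r (-t) = r t
  zero : r 0 = 1
  map_sum : ∀ (k : ℕ) (t c : Fin k → ℝ), (∀ i, 0 ≤ t i) →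
      P.map (fun ω => ∑ i, c i * Y (t i) ω)
        = gaussianReal 0 (Real.toNNReal (∑ i, ∑ j, c i * c j * r (t i - t j)))

namespace IsStationaryGaussian

variable {Ω : Type*} [MeasurableSpace Ω] {P : Measure Ω} {Y : ℝ → Ω → ℝ} {r : ℝ → ℝ}

theorem measurable_eval (h : IsStationaryGaussian P Y r) (t : ℝ) : Measurable (Y t) :=
  h.measurable.comp measurable_prodMk_left

theorem map_pair (h : IsStationaryGaussian P Y r) {s t : ℝ} (hs : 0 ≤ s) (ht : 0 ≤ t) (a b : ℝ) :
    P.map (fun ω => a * Y s ω + b * Y t ω)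
      = gaussianReal 0 (Real.toNNReal (a ^ 2 + 2 * a * b * r (s - t) + b ^ 2)) := by
  have := h.map_sum 2 ![s, t] ![a, b] (by intro i; fin_cases i <;> simpa)
  simp only [Fin.sum_univ_two, Matrix.cons_val_zero, Matrix.cons_val_one, sub_self, h.zero] at this
  rw [this, show t - s = -(s - t) by ring, h.even]
  congr 2
  ring

theorem map_eval (h : IsStationaryGaussian P Y r) {t : ℝ} (ht : 0 ≤ t) :
    P.map (Y t) = gaussianReal 0 1 := by
  have := h.map_pair ht ht 1 0
  simpa using this

theorem integrable_comp (h : IsStationaryGaussian P Y r) {t : ℝ} (ht : 0 ≤ t) {f : ℝ → ℝ}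
    (hf : Integrable f (gaussianReal 0 1)) : Integrable (fun ω => f (Y t ω)) P := by
  rw [← h.map_eval ht] at hf
  exact hf.comp_measurable (h.measurable_eval t)

theorem integral_comp (h : IsStationaryGaussian P Y r) {t : ℝ} (ht : 0 ≤ t) {f : ℝ → ℝ}
    (hf : Measurable f) : ∫ ω, f (Y t ω) ∂P = ∫ x, f x ∂(gaussianReal 0 1) := by
  rw [← h.map_eval ht, integral_map (h.measurable_eval t).aemeasurable hf.aestronglyMeasurable]

theorem abs_cov_le_one (h : IsStationaryGaussian P Y r) (t : ℝ) : |r t| ≤ 1 := by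
  wlog ht : 0 ≤ t generalizing t
  · rw [← h.even]
    exact this _ (by linarith)
  have hi : Integrable (fun x : ℝ => x ^ 2) (gaussianReal 0 1) := integrable_pow_gaussianReal 1 2
  have i1 := h.integrable_comp ht hi
  have i2 := h.integrable_comp le_rfl hi
  have e1 := h.integral_comp ht (f := fun x => x ^ 2) (by fun_prop)
  have e2 := h.integral_comp le_rfl (f := fun x => x ^ 2) (by fun_prop)
  rw [integral_sq_gaussianReal] at e1 e2
  have hm : ∀ b : ℝ, ∫ ω, (1 * Y t ω + b * Y 0 ω) ^ 2 ∂P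
      = max (1 ^ 2 + 2 * 1 * b * r (t - 0) + b ^ 2) 0 := by
    intro b
    have := integral_sq_gaussianReal (Real.toNNReal (1 ^ 2 + 2 * 1 * b * r (t - 0) + b ^ 2))
    rw [← h.map_pair ht le_rfl, integral_map (by
      have := h.measurable_eval t
      have := h.measurable_eval 0
      fun_prop) (by fun_prop)] at this
    rw [this, Real.coe_toNNReal']
  have hs : ∀ b : ℝ, Integrable (fun ω => (1 * Y t ω + b * Y 0 ω) ^ 2) P := by
    intro b
    have hb := h.map_pair ht le_rfl 1 b
    have := integrable_pow_gaussianReal (Real.toNNReal (1 ^ 2 + 2 * 1 * b * r (t - 0) + b ^ 2)) 2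
    rw [← hb] at this
    exact this.comp_measurable (by
      have := h.measurable_eval t
      have := h.measurable_eval 0
      fun_prop)
  have key : (∫ ω, (1 * Y t ω + 1 * Y 0 ω) ^ 2 ∂P) + ∫ ω, (1 * Y t ω + (-1) * Y 0 ω) ^ 2 ∂P
      = 2 * (∫ ω, Y t ω ^ 2 ∂P) + 2 * ∫ ω, Y 0 ω ^ 2 ∂P := by
    rw [← integral_add (hs 1) (hs (-1)), ← integral_const_mul, ← integral_const_mul,
      ← integral_add (i1.const_mul 2) (i2.const_mul 2)]
    congr 1
    funext ω
    ring
  rw [hm, hm, e1, e2, sub_zero, NNReal.coe_one] at key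
  rw [abs_le]
  constructor
  · have := le_max_left (1 ^ 2 + 2 * 1 * (-1) * r t + (-1) ^ 2) 0
    have := le_max_right (1 ^ 2 + 2 * 1 * 1 * r t + 1 ^ 2) 0
    linarith
  · have := le_max_left (1 ^ 2 + 2 * 1 * 1 * r t + 1 ^ 2) 0
    have := le_max_right (1 ^ 2 + 2 * 1 * (-1) * r t + (-1) ^ 2) 0
    linarith

theorem integral_mul_comp [IsProbabilityMeasure P]
    (h : IsStationaryGaussian P Y r) {s t : ℝ} (hs : 0 ≤ s) (ht : 0 ≤ t)
    {f g : ℝ → ℝ} (hf : Measurable f) (hg : Measurable g) :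
    ∫ ω, f (Y s ω) * g (Y t ω) ∂P = ∫ p : ℝ × ℝ, f p.1 *
      g (r (s - t) * p.1 + √(1 - r (s - t) ^ 2) * p.2)
        ∂((gaussianReal 0 1).prod (gaussianReal 0 1)) := by
  have hm := map_prodMk_eq_of_gaussian_combinations (h.measurable_eval s) (h.measurable_eval t)
    (h.abs_cov_le_one (s - t)) (h.map_pair hs ht)
  have hfg : Measurable (fun p : ℝ × ℝ => f p.1 * g p.2) := by fun_prop
  have h1 := integral_map (μ := P) ((h.measurable_eval s).prodMk (h.measurable_eval t)).aemeasurable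
    hfg.aestronglyMeasurable
  rw [hm, integral_map (by fun_prop) hfg.aestronglyMeasurable] at h1
  exact h1.symm

theorem integral_mul [IsProbabilityMeasure P]
    (h : IsStationaryGaussian P Y r) {s t : ℝ} (hs : 0 ≤ s) (ht : 0 ≤ t) :
    ∫ ω, Y s ω * Y t ω ∂P = r (s - t) :=
  (h.integral_mul_comp hs ht (f := fun x => x) (g := fun x => x) measurable_id measurable_id).trans
    (integral_mul_correlated _ _)

theorem measurable_cov [IsProbabilityMeasure P]
    (h : IsStationaryGaussian P Y r) : Measurable r := by
  have e : r = fun t => ∫ ω, Y |t| ω * Y 0 ω ∂P := by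
    funext t
    rw [h.integral_mul (abs_nonneg t) le_rfl, sub_zero]
    rcases abs_choice t with e | e <;> rw [e]
    rw [h.even]
  rw [e]
  have hm : Measurable (fun p : ℝ × Ω => Y |p.1| p.2 * Y 0 p.2) := by
    have h1 : Measurable (fun p : ℝ × Ω => Y |p.1| p.2) :=
      h.measurable.comp (f := fun p : ℝ × Ω => (|p.1|, p.2)) (by fun_prop)
    exact h1.mul ((h.measurable_eval 0).comp measurable_snd)
  exact hm.stronglyMeasurable.integral_prod_right.measurable

theorem measurable_comp_scaled (h : IsStationaryGaussian P Y r) {f : ℝ → ℝ} (hf : Measurable f)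
    (T : ℝ) : Measurable (Function.uncurry fun v ω => f (Y (T * v) ω)) :=
  hf.comp (h.measurable.comp (f := fun p : ℝ × Ω => (T * p.1, p.2)) (by fun_prop))

theorem integrable_sq_comp_scaled [IsProbabilityMeasure P]
    (h : IsStationaryGaussian P Y r) {f : ℝ → ℝ} (hf : Measurable f)
    {K : ℝ} (hK : ∀ x, |f x| ≤ K * (1 + x ^ 2)) {T : ℝ} (hT : 0 ≤ T) :
    Integrable (fun p : ℝ × Ω => f (Y (T * p.1) p.2) ^ 2) (unitUniform.prod P) := by
  have hi : Integrable (fun x => f x ^ 2) (gaussianReal 0 1) := by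
    have h2 := integrable_pow_gaussianReal 1 2
    have h4 := integrable_pow_gaussianReal 1 4
    have hq : Integrable (fun x : ℝ => K ^ 2 * (1 + x ^ 2) ^ 2) (gaussianReal 0 1) := by
      refine ((((integrable_const (1 : ℝ)).add (h2.const_mul 2)).add h4).const_mul (K ^ 2)).congr
        (ae_of_all _ fun x => ?_)
      simp only [Pi.add_apply]
      ring
    refine hq.mono' (hf.pow_const 2).aestronglyMeasurable (ae_of_all _ fun x => ?_)
    rw [norm_pow, Real.norm_eq_abs, ← mul_pow]
    exact pow_le_pow_left₀ (abs_nonneg _) (hK x) 2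
  refine integrable_sq_uncurry (F := fun v ω => f (Y (T * v) ω)) (h.measurable_comp_scaled hf T)
    (M := ∫ x, f x ^ 2 ∂(gaussianReal 0 1)) ?_ ?_
  · filter_upwards [ae_pos_unitUniform] with v hv
    exact h.integrable_comp (mul_nonneg hT hv.le) hi
  · filter_upwards [ae_pos_unitUniform] with v hv
    exact (h.integral_comp (mul_nonneg hT hv.le) (hf.pow_const 2)).le

theorem integral_sq_scaled [IsProbabilityMeasure P]
    (h : IsStationaryGaussian P Y r) {T : ℝ} (hT : 0 ≤ T) :
    ∫ ω, (∫ v, Y (T * v) ω ∂unitUniform) ^ 2 ∂P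
      = ∫ q, r (T * (q.1 - q.2)) ∂(unitUniform.prod unitUniform) := by
  have hi := h.integrable_sq_comp_scaled (f := fun x => x) measurable_id (K := 1)
    abs_le_one_mul_one_add_sq hT
  rw [integral_sq_integral (F := fun v ω => Y (T * v) ω)
    (h.measurable_comp_scaled measurable_id T) hi]
  refine integral_congr_ae ?_
  filter_upwards [ae_pos_unitUniform_prod] with q hq
  rw [h.integral_mul (mul_nonneg hT hq.1.le) (mul_nonneg hT hq.2.le), mul_sub]

theorem exists_integral_sq_comp_le [IsProbabilityMeasure P]
    (h : IsStationaryGaussian P Y r) {g : ℝ → ℝ}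
    (hg : HasHermiteRankTwo g) : ∃ K, ∀ T, 0 ≤ T →
      ∫ ω, (∫ v, g (Y (T * v) ω) ∂unitUniform) ^ 2 ∂P
        ≤ K * ∫ q, r (T * (q.1 - q.2)) ^ 2 ∂(unitUniform.prod unitUniform) := by
  obtain ⟨K, hK0, hK⟩ := hg.exists_abs_integral_le
  obtain ⟨hm, L, hL0, hL, -⟩ := hg
  refine ⟨K, fun T hT => ?_⟩
  have hi := h.integrable_sq_comp_scaled hm hL hT
  have hF := h.measurable_comp_scaled hm T
  rw [integral_sq_integral (F := fun v ω => g (Y (T * v) ω)) hF hi, ← integral_const_mul]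
  refine integral_mono_ae (integrable_mul_prod_prod hF hi).integral_prod_left ?_ ?_
  · refine (Integrable.of_bound (C := 1) ?_ (ae_of_all _ fun q => ?_)).const_mul K
    · have := h.measurable_cov
      exact Measurable.aestronglyMeasurable (by fun_prop)
    · rw [norm_pow, Real.norm_eq_abs]
      exact pow_le_one₀ (abs_nonneg _) (h.abs_cov_le_one _)
  · filter_upwards [ae_pos_unitUniform_prod] with q hq
    rw [h.integral_mul_comp (mul_nonneg hT hq.1.le) (mul_nonneg hT hq.2.le) hm hm, mul_sub]
    refine (le_abs_self _).trans ?_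
    exact hK _ (h.abs_cov_le_one _)

theorem memLp_two_eval (h : IsStationaryGaussian P Y r) {t : ℝ} (ht : 0 ≤ t) :
    MemLp (Y t) 2 P := by
  rw [memLp_two_iff_integrable_sq (h.measurable_eval t).aestronglyMeasurable]
  exact h.integrable_comp ht (f := fun x => x ^ 2) (integrable_pow_gaussianReal 1 2)

theorem map_span_eq_gaussianReal [IsProbabilityMeasure P]
    (h : IsStationaryGaussian P Y r) {z : Lp ℝ 2 P}
    (hz : z ∈ Submodule.span ℝ
      (range fun t : {t : ℝ // 0 ≤ t} => (h.memLp_two_eval t.2).toLp (Y t))) :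
    P.map z = gaussianReal 0 (Real.toNNReal (‖z‖ ^ 2)) := by
  obtain ⟨k, c, g, hg⟩ := Submodule.mem_span_set'.1 hz
  choose t ht using fun i => (g i).2
  have hzm : (z : Ω → ℝ) =ᵐ[P] fun ω => ∑ i, c i * Y (t i) ω := by
    rw [← hg]
    have h2 : ∀ᵐ ω ∂P, ∀ i, (c i • (g i : Lp ℝ 2 P) : Lp ℝ 2 P) ω = c i * Y (t i) ω := by
      rw [ae_all_iff]
      intro i
      filter_upwards [Lp.coeFn_smul (c i) (g i : Lp ℝ 2 P),
        (h.memLp_two_eval (t i).2).coeFn_toLp] with ω h1 h2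
      rw [h1, Pi.smul_apply, smul_eq_mul, ← ht i, h2]
    filter_upwards [Lp.coeFn_finsetSum Finset.univ fun i => c i • (g i : Lp ℝ 2 P), h2]
      with ω h1 h2
    rw [h1, Finset.sum_apply]
    exact Finset.sum_congr rfl fun i _ => h2 i
  have hm := h.map_sum k (fun i => t i) c fun i => (t i).2
  have hmeas : Measurable (fun ω => ∑ i, c i * Y (t i) ω) :=
    Finset.measurable_sum _ fun i _ => (h.measurable_eval _).const_mul _
  have hv := integral_sq_gaussianReal
    (Real.toNNReal (∑ i, ∑ j, c i * c j * r (t i - t j)))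
  rw [← hm, integral_map hmeas.aemeasurable (by fun_prop)] at hv
  rw [Measure.map_congr hzm, hm]
  congr 1
  rw [← NNReal.coe_inj, ← hv, Real.coe_toNNReal _ (sq_nonneg _), ← real_inner_self_eq_norm_sq,
    L2.inner_def]
  refine integral_congr_ae ?_
  filter_upwards [hzm] with ω hω
  rw [hω, real_inner_self_eq_norm_sq, Real.norm_eq_abs, sq_abs]

theorem integrable_sq_scaled [IsProbabilityMeasure P]
    (h : IsStationaryGaussian P Y r) {T : ℝ} (hT : 0 ≤ T) :
    Integrable (fun p : ℝ × Ω => Y (T * p.1) p.2 ^ 2) (unitUniform.prod P) :=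
  h.integrable_sq_comp_scaled (f := fun x => x) measurable_id (K := 1)
    abs_le_one_mul_one_add_sq hT

theorem map_integral_scaled [IsProbabilityMeasure P]
    (h : IsStationaryGaussian P Y r) {T : ℝ} (hT : 0 ≤ T) :
    P.map (fun ω => ∫ v, Y (T * v) ω ∂unitUniform)
      = gaussianReal 0
          (Real.toNNReal (∫ q, r (T * (q.1 - q.2)) ∂(unitUniform.prod unitUniform))) := by
  have hF : Measurable (Function.uncurry fun v ω => Y (T * v) ω) :=
    h.measurable_comp_scaled measurable_id T
  have hi := h.integrable_sq_scaled hT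
  have hI := memLp_two_integral hF hi
  rw [← h.integral_sq_scaled hT, ← norm_toLp_sq hI, Measure.map_congr hI.coeFn_toLp.symm]
  set S := Submodule.span ℝ
      (range fun t : {t : ℝ // 0 ≤ t} => (h.memLp_two_eval t.2).toLp (Y t)) with hS
  have hcl : hI.toLp _ ∈ S.topologicalClosure := by
    rw [← Submodule.orthogonal_orthogonal_eq_closure, Submodule.mem_orthogonal]
    intro Z hZ
    have hZ0 : ∀ t, 0 ≤ t → ∫ ω, Y t ω * Z ω ∂P = 0 := by
      intro t ht
      have := (Submodule.mem_orthogonal _ _).1 hZ _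
        (Submodule.subset_span (mem_range_self (⟨t, ht⟩ : {t : ℝ // 0 ≤ t})))
      rw [L2.inner_def] at this
      rw [← this]
      refine integral_congr_ae ?_
      filter_upwards [(h.memLp_two_eval ht).coeFn_toLp] with ω hω
      rw [hω, real_inner_eq_re_inner]
      simp [mul_comm]
    have hZm : Measurable Z := (Lp.stronglyMeasurable Z).measurable
    have hprod : Integrable (Function.uncurry fun (v : ℝ) (ω : Ω) => Y (T * v) ω * Z ω)
        (unitUniform.prod P) := by
      have hmp : MeasurePreserving Prod.snd (unitUniform.prod P) P := measurePreserving_snd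
      have hL1 : MemLp (fun p : ℝ × Ω => Y (T * p.1) p.2) 2 (unitUniform.prod P) :=
        (memLp_two_iff_integrable_sq hF.aestronglyMeasurable).2 hi
      exact hL1.integrable_mul ((Lp.memLp Z).comp_measurePreserving hmp)
    rw [L2.inner_def]
    calc _ = ∫ ω, ∫ v, Y (T * v) ω * Z ω ∂unitUniform ∂P := by
          refine integral_congr_ae ?_
          filter_upwards [hI.coeFn_toLp] with ω hω
          rw [hω, integral_mul_const]
          simp
      _ = ∫ v, ∫ ω, Y (T * v) ω * Z ω ∂P ∂unitUniform :=
          (integral_integral_swap hprod).symm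
      _ = 0 := by
          refine integral_eq_zero_of_ae ?_
          filter_upwards [ae_pos_unitUniform] with v hv
          exact hZ0 _ (mul_nonneg hT hv.le)
  exact closure_minimal (fun z hz => h.map_span_eq_gaussianReal hz)
    (isClosed_setOf_map_eq_gaussianReal P) hcl

theorem measurable_integral_comp_scaled (h : IsStationaryGaussian P Y r) {f : ℝ → ℝ}
    (hf : Measurable f) (T : ℝ) : Measurable fun ω => ∫ v, f (Y (T * v) ω) ∂unitUniform :=
  ((h.measurable_comp_scaled hf T).stronglyMeasurable.integral_prod_left').measurable

theorem tendstoInMeasure_rankTwo [IsProbabilityMeasure P]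
    (h : IsStationaryGaussian P Y r) {H C : ℝ}
    (hH : H ∈ Set.Ioo (1 / 2 : ℝ) 1)
    (hlim : Tendsto (fun t : ℝ => r t / t ^ (2 * H - 2)) atTop (nhds C))
    {g : ℝ → ℝ} (hg : HasHermiteRankTwo g) :
    TendstoInMeasure P (fun T ω => T ^ (1 - H) * ∫ v, g (Y (T * v) ω) ∂unitUniform) atTop
      (fun _ => 0) := by
  obtain ⟨hH1, hH2⟩ := hH
  obtain ⟨K, hK⟩ := h.exists_integral_sq_comp_le hg
  obtain ⟨hgm, L, -, hL, -⟩ := hg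
  refine tendstoInMeasure_zero_of_tendsto_integral_sq
    (fun T => (h.measurable_integral_comp_scaled hgm T).const_mul _) ?_ ?_
  · filter_upwards [eventually_ge_atTop 0] with T hT
    exact (memLp_two_integral (h.measurable_comp_scaled hgm T)
      (h.integrable_sq_comp_scaled hgm hL hT)).const_mul _
  · have hs := tendsto_scaled_double_integral (h := fun t => r t ^ 2) (p := 2 * H - 2) (C := 0)
      (h.measurable_cov.pow_const 2) (fun t => by simp only [h.even])
      (fun t => by
        rw [abs_pow]
        exact pow_le_one₀ (abs_nonneg _) (h.abs_cov_le_one t))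
      (by linarith) (by linarith) (tendsto_sq_div_rpow (by linarith) hlim)
    have hs' := hs.const_mul K
    simp only [zero_mul, integral_zero, mul_zero] at hs'
    refine squeeze_zero' (Eventually.of_forall fun T => integral_nonneg fun ω => sq_nonneg _) ?_ hs'
    filter_upwards [eventually_gt_atTop 0] with T hT
    simp only [mul_pow]
    rw [integral_const_mul, show (T ^ (1 - H)) ^ 2 = T ^ (-(2 * H - 2)) by
      rw [← Real.rpow_natCast, ← Real.rpow_mul hT.le]; congr 1; push_cast; ring]
    calc _ ≤ T ^ (-(2 * H - 2)) * (K * _) :=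
          mul_le_mul_of_nonneg_left (hK T hT.le) (by positivity)
      _ = _ := by ring

theorem tendstoInDistribution_integral [IsProbabilityMeasure P]
    (h : IsStationaryGaussian P Y r) {H C : ℝ}
    (hH : H ∈ Set.Ioo (1 / 2 : ℝ) 1)
    (hlim : Tendsto (fun t : ℝ => r t / t ^ (2 * H - 2)) atTop (nhds C)) :
    TendstoInDistribution (fun T ω => T ^ (1 - H) * ∫ v, Y (T * v) ω ∂unitUniform) atTop
      id (fun _ => P) (gaussianReal 0 (Real.toNNReal
        (∫ q, C * |q.1 - q.2| ^ (2 * H - 2) ∂(unitUniform.prod unitUniform)))) := by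
  obtain ⟨hH1, hH2⟩ := hH
  have hmeas : ∀ T : ℝ, Measurable fun ω => ∫ v, Y (T * v) ω ∂unitUniform := fun T =>
    h.measurable_integral_comp_scaled (f := fun x => x) measurable_id T
  refine ⟨fun T => ((hmeas T).const_mul _).aemeasurable, aemeasurable_id, ?_⟩
  have hs := tendsto_scaled_double_integral (h := r) (p := 2 * H - 2) (C := C)
    h.measurable_cov h.even h.abs_cov_le_one (by linarith) (by linarith) hlim
  have hc := (continuous_centeredGaussian.tendsto _).comp
    ((continuous_real_toNNReal.tendsto _).comp hs)
  have hlaw : ∀ (v : NNReal) (μ : ProbabilityMeasure ℝ), (μ : Measure ℝ) = gaussianReal 0 v →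
      centeredGaussian v = μ := fun v μ e => Subtype.ext e.symm
  rw [hlaw _ ⟨_, _⟩ Measure.map_id] at hc
  refine hc.congr' ?_
  filter_upwards [eventually_gt_atTop 0] with T hT
  refine hlaw _ _ (Eq.symm ?_)
  have := Measure.map_map (μ := P) (measurable_const_mul (T ^ (1 - H))) (hmeas T)
  rw [h.map_integral_scaled hT.le, gaussianReal_map_const_mul, mul_zero] at this
  rw [Function.comp_def] at this
  refine Eq.trans (congrArg _ ?_) this
  simp only [Function.comp_apply]
  rw [← NNReal.coe_inj, Real.toNNReal_mul (by positivity), NNReal.coe_mul, NNReal.coe_mul,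
    NNReal.coe_mk, Real.coe_toNNReal _ (by positivity)]
  congr 1
  rw [← Real.rpow_natCast, ← Real.rpow_mul hT.le]
  congr 1
  push_cast
  ring

theorem tendstoInDistribution_pair [IsProbabilityMeasure P]
    (h : IsStationaryGaussian P Y r) {H C : ℝ}
    (hH : H ∈ Set.Ioo (1 / 2 : ℝ) 1)
    (hlim : Tendsto (fun t : ℝ => r t / t ^ (2 * H - 2)) atTop (nhds C))
    {g₁ g₂ : ℝ → ℝ} (hg₁ : HasHermiteRankTwo g₁) (hg₂ : HasHermiteRankTwo g₂) (c₁ c₂ : ℝ) :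
    TendstoInDistribution (fun T ω =>
        (c₁ * (T ^ (1 - H) * ∫ v, Y (T * v) ω ∂unitUniform)
            + T ^ (1 - H) * ∫ v, g₁ (Y (T * v) ω) ∂unitUniform,
          c₂ * (T ^ (1 - H) * ∫ v, Y (T * v) ω ∂unitUniform)
            + T ^ (1 - H) * ∫ v, g₂ (Y (T * v) ω) ∂unitUniform)) atTop
      (fun x => (c₁ * x, c₂ * x)) (fun _ => P) (gaussianReal 0 (Real.toNNReal
        (∫ q, C * |q.1 - q.2| ^ (2 * H - 2) ∂(unitUniform.prod unitUniform)))) := by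
  have h1 := (h.tendstoInDistribution_integral hH hlim).prodMk_of_tendstoInMeasure_const _ _ _
    (h.tendstoInMeasure_rankTwo hH hlim hg₁)
    fun T => ((h.measurable_integral_comp_scaled hg₁.1 T).const_mul _).aemeasurable
  have h2 := h1.prodMk_of_tendstoInMeasure_const _ _ _
    (h.tendstoInMeasure_rankTwo hH hlim hg₂)
    fun T => ((h.measurable_integral_comp_scaled hg₂.1 T).const_mul _).aemeasurable
  have h3 := h2.continuous_comp
    (g := fun p : (ℝ × ℝ) × ℝ => (c₁ * p.1.1 + p.1.2, c₂ * p.1.1 + p.2)) (by fun_prop)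
  simpa [Function.comp_def] using h3

theorem ae_integrable_comp_scaled [IsProbabilityMeasure P]
    (h : IsStationaryGaussian P Y r) {f : ℝ → ℝ} (hf : Measurable f)
    {K : ℝ} (hK : ∀ x, |f x| ≤ K * (1 + x ^ 2)) {T : ℝ} (hT : 0 ≤ T) :
    ∀ᵐ ω ∂P, Integrable (fun v => f (Y (T * v) ω)) unitUniform := by
  have hL : MemLp (fun p : ℝ × Ω => f (Y (T * p.1) p.2)) 2 (unitUniform.prod P) :=
    (memLp_two_iff_integrable_sq (h.measurable_comp_scaled hf T).aestronglyMeasurable).2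
      (h.integrable_sq_comp_scaled hf hK hT)
  exact (hL.integrable one_le_two).prod_left_ae

theorem ae_integral_sub_eq [IsProbabilityMeasure P]
    (h : IsStationaryGaussian P Y r) {f g : ℝ → ℝ} {c m : ℝ}
    (hg : HasHermiteRankTwo g) (hf : ∀ y, f y = c * y + g y + m) (a : ℝ) {T : ℝ} (hT : 0 ≤ T) :
    ∀ᵐ ω ∂P, a * (∫ v, f (Y (T * v) ω) ∂unitUniform - m)
      = c * (a * ∫ v, Y (T * v) ω ∂unitUniform) + a * ∫ v, g (Y (T * v) ω) ∂unitUniform := by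
  obtain ⟨hgm, L, -, hL, -⟩ := hg
  filter_upwards [h.ae_integrable_comp_scaled hgm hL hT,
    h.ae_integrable_comp_scaled (f := fun x => x) measurable_id (K := 1)
    abs_le_one_mul_one_add_sq hT] with ω h1 h2
  simp only [hf]
  have h3 : Integrable (fun v => c * Y (T * v) ω + g (Y (T * v) ω)) unitUniform :=
    (h2.const_mul c).add h1
  rw [integral_add h3 (integrable_const m), integral_add (h2.const_mul c) h1,
    integral_const_mul, integral_const]
  simp only [probReal_univ, one_smul]
  ring

end IsStationaryGaussian

/-- Theorem 3.2, case (3): central limit theorem for the moment estimators under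
long-range dependence (`r(t)/t^{2H-2} → C`, `H ∈ (1/2, 1)`). Convergence in distribution is expressed via
bounded continuous test functions, and the limiting centered bivariate Gaussian law is
characterised by the Gaussianity of all its linear functionals. -/
theorem moment_estimator_clt_long_range
    {Ω : Type*} [MeasurableSpace Ω] (P : Measure Ω) [IsProbabilityMeasure P]
    (Y : ℝ → Ω → ℝ) (hYmeas : Measurable (Function.uncurry Y))
    (r : ℝ → ℝ) (hreven : ∀ t, r (-t) = r t) (hr0 : r 0 = 1)
    (hGauss : ∀ (k : ℕ) (t c : Fin k → ℝ), (∀ i, 0 ≤ t i) →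
      P.map (fun ω => ∑ i, c i * Y (t i) ω)
        = gaussianReal 0 (Real.toNNReal (∑ i, ∑ j, c i * c j * r (t i - t j))))
    (H : ℝ) (hH : H ∈ Set.Ioo (1 / 2 : ℝ) 1) (C : ℝ)
    (hrlim : Tendsto (fun t : ℝ => r t / t ^ (2 * H - 2)) atTop (nhds C))
    (αp αm : ℝ) (hαp : 0 < αp) (hαm : 0 < αm) (hne : αp ≠ αm)
    (X : ℝ → Ω → ℝ)
    (hX : ∀ t ω, X t ω = αp * Y t ω * (if 0 < Y t ω then (1 : ℝ) else 0)
            + αm * Y t ω * (if Y t ω < 0 then (1 : ℝ) else 0))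
    (m1 m2 : ℝ → Ω → ℝ)
    (hm1 : ∀ T ω, m1 T ω = (1 / T) * ∫ u in Set.Ioc (0 : ℝ) T, X u ω)
    (hm2 : ∀ T ω, m2 T ω = (1 / T) * ∫ u in Set.Ioc (0 : ℝ) T, (X u ω) ^ 2)
    (μ1 μ2 : ℝ)
    (hμ1 : μ1 = (αp - αm) / Real.sqrt (2 * π))
    (hμ2 : μ2 = (αp ^ 2 + αm ^ 2) / 2) :
    ∃ S : Matrix (Fin 2) (Fin 2) ℝ, S.PosSemidef ∧
      ∃ μ : Measure (ℝ × ℝ), IsProbabilityMeasure μ ∧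
        (∀ c d : ℝ, μ.map (fun x => c * x.1 + d * x.2)
          = gaussianReal 0
              (Real.toNNReal (c ^ 2 * S 0 0 + 2 * c * d * S 0 1 + d ^ 2 * S 1 1)))
        ∧ ∀ f : BoundedContinuousFunction (ℝ × ℝ) ℝ,
            Tendsto (fun T : ℝ =>
                ∫ ω, f (T ^ (1 - H) * (m1 T ω - μ1), T ^ (1 - H) * (m2 T ω - μ2)) ∂P)
              atTop (nhds (∫ x, f x ∂μ)) := by
  have h : IsStationaryGaussian P Y r := ⟨hYmeas, hreven, hr0, hGauss⟩
  set κ : ℝ := √(2 / π) with hκ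
  set φ : ℝ → ℝ := fun y => αp * y * (if 0 < y then (1 : ℝ) else 0)
    + αm * y * (if y < 0 then (1 : ℝ) else 0) with hφ
  have hXφ : ∀ t ω, X t ω = φ (Y t ω) := hX
  have hg₁ := hasHermiteRankTwo_abs_sub.const_mul ((αp - αm) / 2)
  have hg₂ := (hasHermiteRankTwo_sq_sub_one.const_mul ((αp ^ 2 + αm ^ 2) / 2)).add
    (hasHermiteRankTwo_mul_abs_sub.const_mul ((αp ^ 2 - αm ^ 2) / 2))
  rw [← hκ] at hg₁ hg₂
  have hφ₁ : ∀ y, φ y = (αp + αm) / 2 * y + (αp - αm) / 2 * (|y| - κ) + μ1 := by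
    intro y
    rw [hμ1, hκ, sqrt_two_div_pi_eq]
    rcases lt_trichotomy y 0 with hy | hy | hy
    · simp only [hφ, hy, hy.not_gt, if_true, if_false, abs_of_neg hy]
      ring
    · simp only [hφ, hy, lt_irrefl, if_false, abs_zero]
      ring
    · simp only [hφ, hy, hy.not_gt, if_true, if_false, abs_of_pos hy]
      ring
  have hφ₂ : ∀ y, φ y ^ 2 = (αp ^ 2 - αm ^ 2) * κ * y
      + ((αp ^ 2 + αm ^ 2) / 2 * (y ^ 2 - 1)
        + (αp ^ 2 - αm ^ 2) / 2 * (y * |y| - 2 * κ * y)) + μ2 := by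
    intro y
    rw [hμ2]
    rcases lt_trichotomy y 0 with hy | hy | hy
    · simp only [hφ, hy, hy.not_gt, if_true, if_false, abs_of_neg hy]
      ring
    · simp only [hφ, hy, lt_irrefl, if_false, abs_zero]
      ring
    · simp only [hφ, hy, hy.not_gt, if_true, if_false, abs_of_pos hy]
      ring
  set c₁ : ℝ := (αp + αm) / 2
  set c₂ : ℝ := (αp ^ 2 - αm ^ 2) * κ
  set v : NNReal := Real.toNNReal
    (∫ q, C * |q.1 - q.2| ^ (2 * H - 2) ∂(unitUniform.prod unitUniform)) with hv
  have hd := h.tendstoInDistribution_pair hH hrlim hg₁ hg₂ c₁ c₂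
  rw [← hv] at hd
  refine ⟨(v : ℝ) • Matrix.vecMulVec ![c₁, c₂] (star ![c₁, c₂]),
    (Matrix.posSemidef_vecMulVec_self_star _).smul v.2,
    (gaussianReal 0 v).map (fun x => (c₁ * x, c₂ * x)),
    Measure.isProbabilityMeasure_map (by fun_prop), fun c d => ?_, fun f => ?_⟩
  · rw [map_linear_gaussianReal_pair]
    congr 2
    simp
    ring
  · have ht := (ProbabilityMeasure.tendsto_iff_forall_integral_tendsto.1 hd.tendsto) f
    simp only [ProbabilityMeasure.coe_mk] at ht
    refine ht.congr' ?_
    filter_upwards [eventually_gt_atTop 0] with T hT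
    rw [integral_map (hd.forall_aemeasurable T) f.continuous.aestronglyMeasurable]
    refine integral_congr_ae ?_
    filter_upwards [h.ae_integral_sub_eq hg₁ hφ₁ (T ^ (1 - H)) hT.le,
      h.ae_integral_sub_eq (f := fun y => φ y ^ 2) hg₂ hφ₂ (T ^ (1 - H)) hT.le] with ω h1 h2
    rw [← h1, ← h2, hm1, hm2, inv_mul_setIntegral_Ioc (fun u => X u ω) hT,
      inv_mul_setIntegral_Ioc (fun u => X u ω ^ 2) hT]
    simp only [hXφ]
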